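/- arXiv:1811.08130 — 2 statements merged into one kernel-verified Lean document; each statement's English description precedes it below -/
import Mathlib

section
/- Let c₅ = (15/4)^{3/4} and N(x) = |c₅ + x|^{4/3}(c₅ + x) − c₅^{7/3} − (35/4)x. There exists a constant C > 0 such that for all continuous u, v : [0,1] → ℝ: ‖N ∘ u‖_{L²(𝔹⁵)} ≤ C ( ‖u‖²_{L⁵(𝔹⁵)} + ‖u‖^{7/3}_{L^{14/3}(𝔹⁵)} ), and ‖N ∘ u − N ∘ v‖_{L²(𝔹⁵)} ≤ C [ ‖u − v‖_{L⁵(𝔹⁵)} ( ‖u‖_{L⁵(𝔹⁵)} + ‖v‖_{L⁵(𝔹⁵)} ) + ‖u − v‖_{L^{14/3}(𝔹⁵)} ( ‖u‖^{4/3}_{L^{14/3}(𝔹⁵)} + ‖v‖^{4/3}_{L^{14/3}(𝔹⁵)} ) ]. -/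
open Set

/-- The ODE blowup constant `c₅ = (15/4)^{3/4}`. -/
noncomputable def c₅ : ℝ := (15/4 : ℝ) ^ ((3:ℝ)/4)

/-- The nonlinear remainder `N(x) = |c₅+x|^{4/3}(c₅+x) - c₅^{7/3} - (35/4)x`. -/
noncomputable def Nrem (x : ℝ) : ℝ :=
  |c₅ + x| ^ ((4:ℝ)/3) * (c₅ + x) - c₅ ^ ((7:ℝ)/3) - (35/4) * x

open MeasureTheory

lemma c₅_pos : 0 < c₅ := Real.rpow_pos_of_pos (by norm_num) _

lemma c₅_rpow : c₅ ^ ((4:ℝ)/3) = 15/4 := by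
  rw [c₅, ← Real.rpow_mul (by norm_num)]
  norm_num

lemma Nrem_zero : Nrem 0 = 0 := by
  have h : c₅ ^ ((7:ℝ)/3) = c₅ ^ ((4:ℝ)/3) * c₅ := by
    rw [← Real.rpow_add_one c₅_pos.ne']
    norm_num
  simp [Nrem, abs_of_pos c₅_pos, h]

lemma continuous_Nrem : Continuous Nrem := by
  unfold Nrem
  fun_prop (disch := norm_num)

lemma abs_mul_abs_rpow_neg (x : ℝ) : |x| ^ ((4:ℝ)/3 - 2) * |x| = |x| ^ ((1:ℝ)/3) := by
  rcases eq_or_ne x 0 with rfl | hx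
  · simp
  · rw [← Real.rpow_add_one (abs_pos.2 hx).ne']
    norm_num

lemma rpow_four_thirds {x : ℝ} (hx : 0 ≤ x) : x ^ ((4:ℝ)/3) = x ^ ((1:ℝ)/3) * x := by
  rw [← Real.rpow_add_one' hx (by norm_num)]
  norm_num

lemma abs_abs_rpow_sub_le {M x y : ℝ} (hx : |x| ≤ M) (hy : |y| ≤ M) :
    |(|y| ^ ((4:ℝ)/3) - |x| ^ ((4:ℝ)/3))| ≤ 4/3 * M ^ ((1:ℝ)/3) * |y - x| := by
  refine (convex_Icc (-M) M).norm_image_sub_le_of_norm_hasDerivWithin_le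
    (f := fun t : ℝ => |t| ^ ((4:ℝ)/3))
    (fun t _ => (hasDerivAt_abs_rpow t (by norm_num : (1:ℝ) < 4/3)).hasDerivWithinAt)
    (fun t ht => ?_) (abs_le.1 hx) (abs_le.1 hy)
  rw [Real.norm_eq_abs, abs_mul, abs_mul,
    abs_of_nonneg (by positivity : (0:ℝ) ≤ |t| ^ ((4:ℝ)/3 - 2)),
    mul_assoc, abs_mul_abs_rpow_neg, abs_of_pos (by norm_num : (0:ℝ) < 4/3)]
  have := abs_le.2 ht
  gcongr

lemma hasDerivAt_Nrem (x : ℝ) :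
    HasDerivAt Nrem (7/3 * (|c₅ + x| ^ ((4:ℝ)/3) - |c₅| ^ ((4:ℝ)/3))) x := by
  have h1 : HasDerivAt (fun x : ℝ => c₅ + x) 1 x := (hasDerivAt_id x).const_add c₅
  have h2 := (hasDerivAt_abs_rpow (c₅ + x) (by norm_num : (1:ℝ) < 4/3)).comp x h1
  have h3 := ((h2.mul h1).sub_const (c₅ ^ ((7:ℝ)/3))).sub ((hasDerivAt_id x).const_mul (35/4))
  refine h3.congr_deriv ?_
  have h4 : |c₅ + x| ^ ((4:ℝ)/3 - 2) * (c₅ + x) * (c₅ + x) = |c₅ + x| ^ ((4:ℝ)/3) := by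
    rw [rpow_four_thirds (abs_nonneg _), ← abs_mul_abs_rpow_neg, mul_assoc, mul_assoc,
      abs_mul_abs_self]
  rw [abs_of_pos c₅_pos, c₅_rpow]
  simp only [Function.comp]
  linear_combination (4/3) * h4

lemma abs_Nrem_sub_le (x y : ℝ) :
    |Nrem x - Nrem y| ≤ 28/9 * (c₅ ^ ((1:ℝ)/3) + 1) *
      (|x - y| * |x| + |x - y| * |y| + |x - y| * |x| ^ ((4:ℝ)/3) + |x - y| * |y| ^ ((4:ℝ)/3)) := by
  set K := c₅ ^ ((1:ℝ)/3) with hK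
  have hK0 : 0 ≤ K := Real.rpow_nonneg c₅_pos.le _
  set M := max |x| |y| with hM
  have hM0 : 0 ≤ M := le_max_of_le_left (abs_nonneg x)
  have key : |Nrem x - Nrem y| ≤ 28/9 * (K * M + M ^ ((4:ℝ)/3)) * |x - y| := by
    refine (convex_Icc (-M) M).norm_image_sub_le_of_norm_hasDerivWithin_le
      (fun t _ => (hasDerivAt_Nrem t).hasDerivWithinAt)
      (fun t ht => ?_) (abs_le.1 (le_max_right _ _)) (abs_le.1 (le_max_left _ _))
    have ht' : |t| ≤ M := abs_le.2 ht
    have h1 := abs_abs_rpow_sub_le (M := c₅ + M) (x := c₅) (y := c₅ + t)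
      (by rw [abs_of_pos c₅_pos]; linarith)
      ((abs_add_le _ _).trans (by rw [abs_of_pos c₅_pos]; linarith))
    have h2 : (c₅ + M) ^ ((1:ℝ)/3) ≤ K + M ^ ((1:ℝ)/3) :=
      Real.rpow_add_le_add_rpow c₅_pos.le hM0 (by norm_num) (by norm_num)
    rw [add_sub_cancel_left] at h1
    rw [Real.norm_eq_abs, abs_mul, abs_of_pos (by norm_num : (0:ℝ) < 7/3),
      rpow_four_thirds hM0]
    calc _ ≤ 7/3 * (4/3 * (K + M ^ ((1:ℝ)/3)) * M) := by
          gcongr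
          exact h1.trans (by gcongr)
      _ = _ := by ring
  have hM1 : M ≤ |x| + |y| := max_le (by simp) (by simp)
  have hM2 : M ^ ((4:ℝ)/3) ≤ |x| ^ ((4:ℝ)/3) + |y| ^ ((4:ℝ)/3) := by
    have hx : 0 ≤ |x| ^ ((4:ℝ)/3) := by positivity
    have hy : 0 ≤ |y| ^ ((4:ℝ)/3) := by positivity
    rcases max_choice |x| |y| with h | h <;> rw [hM, h] <;> linarith
  calc _ ≤ _ := key
    _ ≤ 28/9 * ((K + 1) * (|x| + |y|) + (K + 1) * (|x| ^ ((4:ℝ)/3) + |y| ^ ((4:ℝ)/3)))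
        * |x - y| := by
      gcongr
      · linarith
      · exact hM2.trans (le_mul_of_one_le_left (by positivity) (by linarith))
    _ = _ := by ring

/-- Hölder's inequality on `[0,1]` with the radial weight `ρ⁴`. -/
lemma weighted_holder {p q : ℝ} (hpq : p.HolderConjugate q) {f g : ℝ → ℝ}
    (hf : ContinuousOn f (Icc 0 1)) (hg : ContinuousOn g (Icc 0 1))
    (hf0 : ∀ x, 0 ≤ f x) (hg0 : ∀ x, 0 ≤ g x) :
    ∫ ρ in (0:ℝ)..1, f ρ * g ρ * ρ^4 ≤
      (∫ ρ in (0:ℝ)..1, f ρ ^ p * ρ^4) ^ (1/p) * (∫ ρ in (0:ℝ)..1, g ρ ^ q * ρ^4) ^ (1/q) := by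
  have memLp {r : ℝ} (hr : 0 < r) {h : ℝ → ℝ} (hh : ContinuousOn h (Icc 0 1)) :
      MemLp (fun ρ => h ρ * ρ ^ (4/r)) (ENNReal.ofReal r) (volume.restrict (Ioc (0:ℝ) 1)) := by
    have hc : ContinuousOn (fun ρ => h ρ * ρ ^ (4/r)) (Icc (0:ℝ) 1) :=
      hh.mul (Real.continuous_rpow_const (by positivity)).continuousOn
    obtain ⟨B, hB⟩ := isCompact_Icc.exists_bound_of_continuousOn hc
    refine MemLp.of_bound
      ((hc.mono Ioc_subset_Icc_self).aestronglyMeasurable measurableSet_Ioc) B ?_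
    filter_upwards [ae_restrict_mem measurableSet_Ioc] with x hx
    exact hB x (Ioc_subset_Icc_self hx)
  have weight {r : ℝ} (hr : 0 < r) {h : ℝ → ℝ} (hh : ∀ x, 0 ≤ h x) :
      ∫ ρ in Ioc (0:ℝ) 1, (h ρ * ρ ^ (4/r)) ^ r = ∫ ρ in Ioc (0:ℝ) 1, h ρ ^ r * ρ^4 := by
    refine setIntegral_congr_fun measurableSet_Ioc fun x hx => ?_
    have : (x ^ (4/r)) ^ r = x^4 := by
      rw [← Real.rpow_mul hx.1.le, div_mul_cancel₀ _ hr.ne']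
      norm_cast
    simp only [Real.mul_rpow (hh x) (Real.rpow_nonneg hx.1.le _), this]
  have nonneg {r : ℝ} {h : ℝ → ℝ} (hh : ∀ x, 0 ≤ h x) :
      0 ≤ᵐ[volume.restrict (Ioc (0:ℝ) 1)] fun ρ => h ρ * ρ ^ (4/r) := by
    filter_upwards [ae_restrict_mem measurableSet_Ioc] with x hx
    exact mul_nonneg (hh x) (Real.rpow_nonneg hx.1.le _)
  have H := integral_mul_le_Lp_mul_Lq_of_nonneg hpq (nonneg (r := p) hf0) (nonneg (r := q) hg0)
    (memLp hpq.pos hf) (memLp hpq.symm.pos hg)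
  rw [weight hpq.pos hf0, weight hpq.symm.pos hg0] at H
  simp only [intervalIntegral.integral_of_le zero_le_one]
  refine le_of_eq_of_le (setIntegral_congr_fun measurableSet_Ioc fun x hx => ?_) H
  have : x ^ (4/p) * x ^ (4/q) = x^4 := by
    rw [← Real.rpow_add hx.1, div_eq_mul_inv, div_eq_mul_inv, ← mul_add, hpq.inv_add_inv_eq_one]
    norm_num
  simp only [← this]
  ring

lemma weighted_integral_nonneg {f : ℝ → ℝ} (hf : ∀ x, 0 ≤ f x) :
    0 ≤ ∫ ρ in (0:ℝ)..1, f ρ * ρ^4 :=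
  intervalIntegral.integral_nonneg zero_le_one fun x _ => mul_nonneg (hf x) (by positivity)

lemma integral_pow_four_le {f : ℝ → ℝ} (hf : ContinuousOn f (Icc 0 1)) :
    ∫ ρ in (0:ℝ)..1, |f ρ|^4 * ρ^4 ≤ (∫ ρ in (0:ℝ)..1, |f ρ|^5 * ρ^4) ^ ((4:ℝ)/5) := by
  have hpq : (5/4 : ℝ).HolderConjugate 5 := by
    rw [Real.holderConjugate_iff]; norm_num
  have H := weighted_holder (f := fun x => |f x| ^ 4) hpq (hf.abs.pow 4)
    (continuousOn_const (c := (1:ℝ)))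
    (fun x => by positivity) (fun _ => zero_le_one)
  have e (x : ℝ) : (|f x| ^ 4) ^ (5/4 : ℝ) = |f x| ^ 5 := by
    rw [← Real.rpow_natCast, ← Real.rpow_mul (abs_nonneg _), ← Real.rpow_natCast]
    norm_num
  simp only [e, mul_one, Real.one_rpow, one_mul, integral_pow] at H
  refine H.trans ?_
  rw [show (1 / (5/4) : ℝ) = 4/5 by norm_num]
  exact mul_le_of_le_one_right
    (Real.rpow_nonneg (weighted_integral_nonneg fun x => by positivity) _)
    (Real.rpow_le_one (by norm_num) (by norm_num) (by norm_num))

lemma norm_mul_le_five {w u : ℝ → ℝ} (hw : ContinuousOn w (Icc 0 1))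
    (hu : ContinuousOn u (Icc 0 1)) :
    (∫ ρ in (0:ℝ)..1, (|w ρ| * |u ρ|)^2 * ρ^4) ^ ((1:ℝ)/2) ≤
      (∫ ρ in (0:ℝ)..1, |w ρ|^5 * ρ^4) ^ ((1:ℝ)/5)
        * (∫ ρ in (0:ℝ)..1, |u ρ|^5 * ρ^4) ^ ((1:ℝ)/5) := by
  have H := weighted_holder (f := fun x => |w x| ^ 2) (g := fun x => |u x| ^ 2)
    Real.HolderConjugate.two_two (hw.abs.pow 2) (hu.abs.pow 2)
    (fun x => by positivity) (fun x => by positivity)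
  have e (t : ℝ) : (|t| ^ 2) ^ (2 : ℝ) = |t| ^ 4 := by
    norm_cast
    ring
  simp only [e, ← mul_pow |w _| |u _|] at H
  have n4 (f : ℝ → ℝ) := weighted_integral_nonneg (f := fun x => |f x|^4) fun x => by positivity
  have n5 (f : ℝ → ℝ) := weighted_integral_nonneg (f := fun x => |f x|^5) fun x => by positivity
  have step {f : ℝ → ℝ} (hf : ContinuousOn f (Icc 0 1)) :
      ((∫ ρ in (0:ℝ)..1, |f ρ|^4 * ρ^4) ^ ((1:ℝ)/2)) ^ ((1:ℝ)/2) ≤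
        (∫ ρ in (0:ℝ)..1, |f ρ|^5 * ρ^4) ^ ((1:ℝ)/5) := by
    rw [← Real.rpow_mul (n4 f)]
    refine (Real.rpow_le_rpow (n4 f) (integral_pow_four_le hf) (by norm_num)).trans_eq ?_
    rw [← Real.rpow_mul (n5 f)]
    norm_num
  refine (Real.rpow_le_rpow (weighted_integral_nonneg fun x => by positivity) H
    (by norm_num)).trans ?_
  rw [Real.mul_rpow (Real.rpow_nonneg (n4 w) _) (Real.rpow_nonneg (n4 u) _)]
  exact mul_le_mul (step hw) (step hu)
    (Real.rpow_nonneg (Real.rpow_nonneg (n4 u) _) _) (Real.rpow_nonneg (n5 w) _)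

lemma norm_mul_rpow_le {w u : ℝ → ℝ} (hw : ContinuousOn w (Icc 0 1))
    (hu : ContinuousOn u (Icc 0 1)) :
    (∫ ρ in (0:ℝ)..1, (|w ρ| * |u ρ| ^ ((4:ℝ)/3))^2 * ρ^4) ^ ((1:ℝ)/2) ≤
      (∫ ρ in (0:ℝ)..1, |w ρ| ^ ((14:ℝ)/3) * ρ^4) ^ ((3:ℝ)/14)
        * (∫ ρ in (0:ℝ)..1, |u ρ| ^ ((14:ℝ)/3) * ρ^4) ^ ((2:ℝ)/7) := by
  have hpq : (7/3 : ℝ).HolderConjugate (7/4) := by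
    rw [Real.holderConjugate_iff]; norm_num
  have H := weighted_holder (f := fun x => |w x| ^ 2)
    (g := fun x => (|u x| ^ ((4:ℝ)/3)) ^ 2) hpq (hw.abs.pow 2)
    ((hu.abs.rpow_const (p := (4:ℝ)/3) fun _ _ => Or.inr (by norm_num)).pow 2)
    (fun x => by positivity) (fun x => by positivity)
  have e1 (t : ℝ) : (|t| ^ 2) ^ (7/3 : ℝ) = |t| ^ ((14:ℝ)/3) := by
    rw [← Real.rpow_natCast, ← Real.rpow_mul (abs_nonneg _)]
    norm_num
  have e2 (t : ℝ) : ((|t| ^ ((4:ℝ)/3)) ^ 2) ^ (7/4 : ℝ) = |t| ^ ((14:ℝ)/3) := by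
    rw [← Real.rpow_natCast, ← Real.rpow_mul (abs_nonneg _), ← Real.rpow_mul (abs_nonneg _)]
    norm_num
  simp only [e1, e2, ← mul_pow |w _| (|u _| ^ ((4:ℝ)/3))] at H
  have n (f : ℝ → ℝ) := weighted_integral_nonneg (f := fun x => |f x| ^ ((14:ℝ)/3))
    fun x => by positivity
  refine (Real.rpow_le_rpow (weighted_integral_nonneg fun x => by positivity) H
    (by norm_num)).trans_eq ?_
  rw [Real.mul_rpow (Real.rpow_nonneg (n w) _) (Real.rpow_nonneg (n u) _),
    ← Real.rpow_mul (n w), ← Real.rpow_mul (n u)]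
  norm_num

lemma norm_Nrem_sub_le {u v : ℝ → ℝ} (hu : ContinuousOn u (Icc 0 1))
    (hv : ContinuousOn v (Icc 0 1)) :
    (∫ ρ in (0:ℝ)..1, |Nrem (u ρ) - Nrem (v ρ)|^2 * ρ^4) ^ ((1:ℝ)/2) ≤
      2 * (28/9 * (c₅ ^ ((1:ℝ)/3) + 1)) *
        ((∫ ρ in (0:ℝ)..1, |u ρ - v ρ|^5 * ρ^4) ^ ((1:ℝ)/5)
          * ((∫ ρ in (0:ℝ)..1, |u ρ|^5 * ρ^4) ^ ((1:ℝ)/5)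
            + (∫ ρ in (0:ℝ)..1, |v ρ|^5 * ρ^4) ^ ((1:ℝ)/5))
        + (∫ ρ in (0:ℝ)..1, |u ρ - v ρ| ^ ((14:ℝ)/3) * ρ^4) ^ ((3:ℝ)/14)
          * ((∫ ρ in (0:ℝ)..1, |u ρ| ^ ((14:ℝ)/3) * ρ^4) ^ ((2:ℝ)/7)
            + (∫ ρ in (0:ℝ)..1, |v ρ| ^ ((14:ℝ)/3) * ρ^4) ^ ((2:ℝ)/7))) := by
  have hw : ContinuousOn (fun ρ => u ρ - v ρ) (Icc 0 1) := hu.sub hv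
  set K := 28/9 * (c₅ ^ ((1:ℝ)/3) + 1) with hK
  have hK0 : 0 ≤ K := by have := c₅_pos; positivity
  have integrable {f : ℝ → ℝ} (hf : ContinuousOn f (Icc 0 1)) :
      IntervalIntegrable (fun ρ => f ρ ^ 2 * ρ^4) volume 0 1 :=
    ContinuousOn.intervalIntegrable_of_Icc zero_le_one
      ((hf.pow 2).mul (continuous_pow 4).continuousOn)
  have hr {f : ℝ → ℝ} (hf : ContinuousOn f (Icc 0 1)) :
      ContinuousOn (fun ρ => |f ρ| ^ ((4:ℝ)/3)) (Icc 0 1) :=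
    hf.abs.rpow_const fun _ _ => Or.inr (by norm_num)
  have i1 := integrable (f := fun ρ => |u ρ - v ρ| * |u ρ|) (hw.abs.mul hu.abs)
  have i2 := integrable (f := fun ρ => |u ρ - v ρ| * |v ρ|) (hw.abs.mul hv.abs)
  have i3 := integrable (f := fun ρ => |u ρ - v ρ| * |u ρ| ^ ((4:ℝ)/3)) (hw.abs.mul (hr hu))
  have i4 := integrable (f := fun ρ => |u ρ - v ρ| * |v ρ| ^ ((4:ℝ)/3)) (hw.abs.mul (hr hv))
  have hN := integrable ((continuous_Nrem.comp_continuousOn hu).sub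
    (continuous_Nrem.comp_continuousOn hv)).abs
  have hmono : ∫ ρ in (0:ℝ)..1, |Nrem (u ρ) - Nrem (v ρ)|^2 * ρ^4 ≤
      ∫ ρ in (0:ℝ)..1, (2 * K)^2 * ((|u ρ - v ρ| * |u ρ|)^2 * ρ^4
        + (|u ρ - v ρ| * |v ρ|)^2 * ρ^4 + (|u ρ - v ρ| * |u ρ| ^ ((4:ℝ)/3))^2 * ρ^4
        + (|u ρ - v ρ| * |v ρ| ^ ((4:ℝ)/3))^2 * ρ^4) := by
    refine intervalIntegral.integral_mono_on zero_le_one hN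
      ((((i1.add i2).add i3).add i4).const_mul _) fun x _ => ?_
    have h := pow_le_pow_left₀ (abs_nonneg _) (abs_Nrem_sub_le (u x) (v x)) 2
    have four (a b c d : ℝ) : (K * (a + b + c + d))^2 ≤ (2*K)^2 * (a^2 + b^2 + c^2 + d^2) := by
      have : (a + b + c + d)^2 ≤ 4 * (a^2 + b^2 + c^2 + d^2) := by
        linarith [sq_nonneg (a-b), sq_nonneg (a-c), sq_nonneg (a-d), sq_nonneg (b-c),
          sq_nonneg (b-d), sq_nonneg (c-d)]
      calc _ = K^2 * (a + b + c + d)^2 := by ring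
        _ ≤ K^2 * (4 * (a^2 + b^2 + c^2 + d^2)) := by gcongr
        _ = _ := by ring
    refine (mul_le_mul_of_nonneg_right (h.trans (four _ _ _ _)) (by positivity)).trans_eq ?_
    ring
  rw [intervalIntegral.integral_const_mul, intervalIntegral.integral_add ((i1.add i2).add i3) i4,
    intervalIntegral.integral_add (i1.add i2) i3, intervalIntegral.integral_add i1 i2] at hmono
  have sq_nonneg' (f : ℝ → ℝ) := weighted_integral_nonneg (f := fun x => f x ^ 2)
    fun x => sq_nonneg _
  have n1 := sq_nonneg' fun ρ => |u ρ - v ρ| * |u ρ|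
  have n2 := sq_nonneg' fun ρ => |u ρ - v ρ| * |v ρ|
  have n3 := sq_nonneg' fun ρ => |u ρ - v ρ| * |u ρ| ^ ((4:ℝ)/3)
  have n4 := sq_nonneg' fun ρ => |u ρ - v ρ| * |v ρ| ^ ((4:ℝ)/3)
  have sub {a b : ℝ} (ha : 0 ≤ a) (hb : 0 ≤ b) :
      (a + b) ^ ((1:ℝ)/2) ≤ a ^ ((1:ℝ)/2) + b ^ ((1:ℝ)/2) :=
    Real.rpow_add_le_add_rpow ha hb (by norm_num) (by norm_num)
  refine (Real.rpow_le_rpow (sq_nonneg' fun ρ => |Nrem (u ρ) - Nrem (v ρ)|) hmono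
    (by norm_num)).trans ?_
  rw [Real.mul_rpow (by positivity) (by positivity), ← Real.sqrt_eq_rpow ((2*K)^2),
    Real.sqrt_sq (by positivity)]
  refine mul_le_mul_of_nonneg_left ?_ (by positivity)
  have b1 := norm_mul_le_five hw hu
  have b2 := norm_mul_le_five hw hv
  have b3 := norm_mul_rpow_le hw hu
  have b4 := norm_mul_rpow_le hw hv
  have s1 := sub (add_nonneg (add_nonneg n1 n2) n3) n4
  have s2 := sub (add_nonneg n1 n2) n3
  have s3 := sub n1 n2
  rw [mul_add, mul_add]
  linarith

/-- Moser-type estimates for the nonlinearity, in radial `Lᵖ(𝔹⁵)` norms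
`‖f‖_{Lᵖ(𝔹⁵)} = (∫₀¹ |f(ρ)|ᵖ ρ⁴ dρ)^{1/p}`:
`‖N∘u‖_{L²} ≲ ‖u‖²_{L⁵} + ‖u‖^{7/3}_{L^{14/3}}` and
`‖N∘u - N∘v‖_{L²} ≲ ‖u-v‖_{L⁵}(‖u‖_{L⁵} + ‖v‖_{L⁵})
  + ‖u-v‖_{L^{14/3}}(‖u‖^{4/3}_{L^{14/3}} + ‖v‖^{4/3}_{L^{14/3}})`. -/
theorem Nrem_moser_estimates :
    ∃ C > (0:ℝ), ∀ u v : ℝ → ℝ,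
      ContinuousOn u (Icc (0:ℝ) 1) → ContinuousOn v (Icc (0:ℝ) 1) →
      (∫ ρ in (0:ℝ)..1, |Nrem (u ρ)|^2 * ρ^4) ^ ((1:ℝ)/2) ≤
          C * ((∫ ρ in (0:ℝ)..1, |u ρ|^5 * ρ^4) ^ ((2:ℝ)/5)
            + (∫ ρ in (0:ℝ)..1, |u ρ| ^ ((14:ℝ)/3) * ρ^4) ^ ((1:ℝ)/2)) ∧
      (∫ ρ in (0:ℝ)..1, |Nrem (u ρ) - Nrem (v ρ)|^2 * ρ^4) ^ ((1:ℝ)/2) ≤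
          C * ((∫ ρ in (0:ℝ)..1, |u ρ - v ρ|^5 * ρ^4) ^ ((1:ℝ)/5)
              * ((∫ ρ in (0:ℝ)..1, |u ρ|^5 * ρ^4) ^ ((1:ℝ)/5)
                + (∫ ρ in (0:ℝ)..1, |v ρ|^5 * ρ^4) ^ ((1:ℝ)/5))
            + (∫ ρ in (0:ℝ)..1, |u ρ - v ρ| ^ ((14:ℝ)/3) * ρ^4) ^ ((3:ℝ)/14)
              * ((∫ ρ in (0:ℝ)..1, |u ρ| ^ ((14:ℝ)/3) * ρ^4) ^ ((2:ℝ)/7)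
                + (∫ ρ in (0:ℝ)..1, |v ρ| ^ ((14:ℝ)/3) * ρ^4) ^ ((2:ℝ)/7))) := by
  refine ⟨2 * (28/9 * (c₅ ^ ((1:ℝ)/3) + 1)), ?_, fun u v hu hv => ⟨?_, norm_Nrem_sub_le hu hv⟩⟩
  · have := c₅_pos
    positivity
  · have H := norm_Nrem_sub_le hu (continuousOn_const (c := (0:ℝ)))
    have n5 := weighted_integral_nonneg (f := fun x => |u x|^5) fun x => by positivity
    have n14 := weighted_integral_nonneg (f := fun x => |u x| ^ ((14:ℝ)/3)) fun x => by positivity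
    have e5 : (∫ ρ in (0:ℝ)..1, |u ρ|^5 * ρ^4) ^ ((2:ℝ)/5) =
        (∫ ρ in (0:ℝ)..1, |u ρ|^5 * ρ^4) ^ ((1:ℝ)/5)
          * (∫ ρ in (0:ℝ)..1, |u ρ|^5 * ρ^4) ^ ((1:ℝ)/5) := by
      rw [← Real.rpow_add_of_nonneg n5 (by norm_num) (by norm_num)]
      norm_num
    have e14 : (∫ ρ in (0:ℝ)..1, |u ρ| ^ ((14:ℝ)/3) * ρ^4) ^ ((1:ℝ)/2) =
        (∫ ρ in (0:ℝ)..1, |u ρ| ^ ((14:ℝ)/3) * ρ^4) ^ ((3:ℝ)/14)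
          * (∫ ρ in (0:ℝ)..1, |u ρ| ^ ((14:ℝ)/3) * ρ^4) ^ ((2:ℝ)/7) := by
      rw [← Real.rpow_add_of_nonneg n14 (by norm_num) (by norm_num)]
      norm_num
    have z5 : (∫ ρ in (0:ℝ)..1, |(0:ℝ)|^5 * ρ^4) ^ ((1:ℝ)/5) = 0 := by simp
    have z14 : (∫ ρ in (0:ℝ)..1, |(0:ℝ)| ^ ((14:ℝ)/3) * ρ^4) ^ ((2:ℝ)/7) = 0 := by
      rw [abs_zero, Real.zero_rpow (by norm_num)]
      simp
    rw [z5, z14] at H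
    simp only [sub_zero, Nrem_zero, add_zero] at H
    rw [e5, e14]
    exact H
end

section
/- There exists a constant C > 0 such that for every x ∈ ℝ \ {0}: ∫₀¹ ρ^{−1/2} |x − log(1+ρ)|^{−1/2} dρ ≤ C (|x|^{−1/2} + 1). (The integral is finite for every such x, since the singularities ρ^{−1/2} at ρ = 0 and |x − log(1+ρ)|^{−1/2} at the possible interior point where log(1+ρ) = x are both integrable.) -/
/-- The function `|u|^{-1/2}` is interval integrable. -/
lemma intervalIntegrable_abs_rpow_neg_half (a b : ℝ) :
    IntervalIntegrable (fun u : ℝ => |u| ^ (-(1:ℝ)/2)) MeasureTheory.volume a b := by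
  have key : ∀ c : ℝ, 0 ≤ c →
      IntervalIntegrable (fun u : ℝ => |u| ^ (-(1:ℝ)/2)) MeasureTheory.volume 0 c := by
    intro c hc
    refine (intervalIntegral.intervalIntegrable_rpow' (r := -(1:ℝ)/2) (by norm_num)).congr ?_
    intro u hu
    rw [Set.uIoc_of_le hc] at hu
    simp only [abs_of_pos hu.1]
  have key' : ∀ c : ℝ,
      IntervalIntegrable (fun u : ℝ => |u| ^ (-(1:ℝ)/2)) MeasureTheory.volume 0 c := by
    intro c
    rcases le_total 0 c with hc | hc
    · exact key c hc
    · rw [IntervalIntegrable.iff_comp_neg]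
      simpa using key (-c) (by linarith)
  exact (key' a).symm.trans (key' b)

/-- On `[0, 1]`, the map `ρ ↦ log (1 + ρ)` expands distances by at least the factor `1/2`. -/
lemma half_abs_sub_le_abs_log_sub {r ρ : ℝ} (hr : r ∈ Set.Icc (0:ℝ) 1)
    (hρ : ρ ∈ Set.Icc (0:ℝ) 1) :
    |r - ρ| / 2 ≤ |Real.log (1 + r) - Real.log (1 + ρ)| := by
  wlog h : ρ ≤ r generalizing r ρ
  · rw [abs_sub_comm r, abs_sub_comm (Real.log (1 + r))]
    exact this hρ hr (le_of_not_ge h)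
  obtain ⟨hr0, hr1⟩ := hr
  obtain ⟨hρ0, hρ1⟩ := hρ
  rw [abs_of_nonneg (by linarith), ← Real.log_div (by linarith) (by linarith)]
  refine le_trans ?_ (le_abs_self _)
  refine le_trans ?_ (Real.one_sub_inv_le_log_of_pos (by positivity))
  rw [inv_div, one_sub_div (by linarith), div_le_div_iff₀ (by norm_num) (by linarith)]
  nlinarith

/-- The distance from `x` to `log (1 + ρ)` is bounded below by the distance of `ρ` to a point
of `[0, 1]` which depends only on `x`. -/
lemma exists_half_abs_sub_le_abs_sub_log (x : ℝ) :
    ∃ r ∈ Set.Icc (0:ℝ) 1, ∀ ρ ∈ Set.Icc (0:ℝ) 1,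
      |r - ρ| / 2 ≤ |x - Real.log (1 + ρ)| := by
  have hlog : ∀ ρ ∈ Set.Icc (0:ℝ) 1, 0 ≤ Real.log (1 + ρ) ∧ Real.log (1 + ρ) ≤ Real.log 2 := by
    rintro ρ ⟨h0, h1⟩
    exact ⟨Real.log_nonneg (by linarith), Real.log_le_log (by linarith) (by linarith)⟩
  rcases le_total x 0 with hx | hx
  · refine ⟨0, by simp, fun ρ hρ => ?_⟩
    refine (half_abs_sub_le_abs_log_sub (by simp) hρ).trans ?_
    have := hlog ρ hρ
    rw [add_zero, Real.log_one, abs_of_nonpos (by linarith), abs_of_nonpos (by linarith)]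
    linarith
  rcases le_total x (Real.log 2) with hx2 | hx2
  · have h1 : 1 ≤ Real.exp x := Real.one_le_exp hx
    have h2 : Real.exp x ≤ 2 := by
      rwa [← Real.le_log_iff_exp_le (by norm_num)]
    have hr : Real.exp x - 1 ∈ Set.Icc (0:ℝ) 1 := ⟨by linarith, by linarith⟩
    refine ⟨Real.exp x - 1, hr, fun ρ hρ => ?_⟩
    simpa using half_abs_sub_le_abs_log_sub hr hρ
  · refine ⟨1, by simp, fun ρ hρ => ?_⟩
    refine (half_abs_sub_le_abs_log_sub (by simp) hρ).trans ?_
    have := hlog ρ hρ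
    rw [one_add_one_eq_two, abs_of_nonneg (by linarith), abs_of_nonneg (by linarith)]
    linarith

/-- If `c ≤ max a b`, then `a^{-1/2} b^{-1/2}` is at most `c^{-1/2} (a^{-1/2} + b^{-1/2})`. -/
lemma rpow_neg_half_mul_le {a b c : ℝ} (hc : 0 < c) (ha : 0 ≤ a) (hb : 0 ≤ b)
    (h : c ≤ a ∨ c ≤ b) :
    a ^ (-(1:ℝ)/2) * b ^ (-(1:ℝ)/2) ≤
      c ^ (-(1:ℝ)/2) * (a ^ (-(1:ℝ)/2) + b ^ (-(1:ℝ)/2)) := by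
  have ha' : 0 ≤ a ^ (-(1:ℝ)/2) := Real.rpow_nonneg ha _
  have hb' : 0 ≤ b ^ (-(1:ℝ)/2) := Real.rpow_nonneg hb _
  have hc' : 0 ≤ c ^ (-(1:ℝ)/2) := Real.rpow_nonneg hc.le _
  rcases h with h | h
  · have := Real.rpow_le_rpow_of_nonpos hc h (show -(1:ℝ)/2 ≤ 0 by norm_num)
    nlinarith [mul_nonneg hc' ha', mul_le_mul_of_nonneg_right this hb']
  · have := Real.rpow_le_rpow_of_nonpos hc h (show -(1:ℝ)/2 ≤ 0 by norm_num)
    nlinarith [mul_nonneg hc' hb', mul_le_mul_of_nonneg_left this ha']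

/-- Integrals of `|r - ρ|^{-1/2}` over `[0, 1]` are bounded uniformly in `r ∈ [0, 1]`. -/
lemma integral_abs_sub_rpow_neg_half_le {r : ℝ} (hr : r ∈ Set.Icc (0:ℝ) 1) :
    (∫ ρ in (0:ℝ)..1, |r - ρ| ^ (-(1:ℝ)/2)) ≤ ∫ u in (-1:ℝ)..1, |u| ^ (-(1:ℝ)/2) := by
  rw [intervalIntegral.integral_comp_sub_left (fun u : ℝ => |u| ^ (-(1:ℝ)/2))]
  refine intervalIntegral.integral_mono_interval (by linarith [hr.1]) (by linarith)
    (by linarith [hr.2]) (Filter.Eventually.of_forall fun u => ?_)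
    (intervalIntegrable_abs_rpow_neg_half _ _)
  exact Real.rpow_nonneg (abs_nonneg u) _

/-- Elementary integral estimate: there is `C > 0` such that for every `x ≠ 0`
the integral `∫₀¹ ρ^{-1/2} |x - log(1+ρ)|^{-1/2} dρ` is finite and bounded by
`C (|x|^{-1/2} + 1)`. -/
theorem log_singular_integral_bound :
    ∃ C > (0:ℝ), ∀ x : ℝ, x ≠ 0 →
      IntervalIntegrable
        (fun ρ : ℝ => ρ ^ (-(1:ℝ)/2) * |x - Real.log (1 + ρ)| ^ (-(1:ℝ)/2))
        MeasureTheory.volume 0 1 ∧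
      (∫ ρ in (0:ℝ)..1, ρ ^ (-(1:ℝ)/2) * |x - Real.log (1 + ρ)| ^ (-(1:ℝ)/2)) ≤
        C * (|x| ^ (-(1:ℝ)/2) + 1) := by
  set K : ℝ := ∫ u in (-1:ℝ)..1, |u| ^ (-(1:ℝ)/2)
  set L : ℝ := ∫ ρ in (0:ℝ)..1, ρ ^ (-(1:ℝ)/2)
  set d : ℝ := (1 / 2 : ℝ) ^ (-(1:ℝ)/2)
  have hd : 0 < d := Real.rpow_pos_of_pos (by norm_num) _
  have hK : 0 ≤ K := intervalIntegral.integral_nonneg (by norm_num)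
    fun u _ => Real.rpow_nonneg (abs_nonneg u) _
  have hL : 0 ≤ L := intervalIntegral.integral_nonneg (by norm_num)
    fun u hu => Real.rpow_nonneg hu.1 _
  refine ⟨d * (L + d * K) + 1, by positivity, fun x hx => ?_⟩
  obtain ⟨r, hr, hrx⟩ := exists_half_abs_sub_le_abs_sub_log x
  have hx' : 0 < |x| := abs_pos.2 hx
  have hmaj_rho : IntervalIntegrable (fun ρ : ℝ => ρ ^ (-(1:ℝ)/2)) MeasureTheory.volume 0 1 :=
    intervalIntegral.intervalIntegrable_rpow' (by norm_num)
  have hmaj_r : IntervalIntegrable (fun ρ : ℝ => |r - ρ| ^ (-(1:ℝ)/2))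
      MeasureTheory.volume 0 1 := by
    simpa using (intervalIntegrable_abs_rpow_neg_half (r - 0) (r - 1)).comp_sub_left r
  have hmaj : IntervalIntegrable
      (fun ρ : ℝ => |x| ^ (-(1:ℝ)/2) * d * (ρ ^ (-(1:ℝ)/2) + d * |r - ρ| ^ (-(1:ℝ)/2)))
      MeasureTheory.volume 0 1 := (hmaj_rho.add (hmaj_r.const_mul d)).const_mul _
  have hle : ∀ ρ ∈ Set.Ioc (0:ℝ) 1, ρ ≠ r →
      ρ ^ (-(1:ℝ)/2) * |x - Real.log (1 + ρ)| ^ (-(1:ℝ)/2) ≤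
        |x| ^ (-(1:ℝ)/2) * d * (ρ ^ (-(1:ℝ)/2) + d * |r - ρ| ^ (-(1:ℝ)/2)) := by
    rintro ρ ⟨hρ0, hρ1⟩ hρr
    have hlog0 : 0 ≤ Real.log (1 + ρ) := Real.log_nonneg (by linarith)
    have hlog1 : Real.log (1 + ρ) ≤ ρ := by
      linarith [Real.log_le_sub_one_of_pos (show 0 < 1 + ρ by linarith)]
    have hmax : |x| * (1 / 2) ≤ ρ ∨ |x| * (1 / 2) ≤ |x - Real.log (1 + ρ)| := by
      by_contra! hcon
      have := abs_sub_abs_le_abs_sub x (Real.log (1 + ρ))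
      rw [abs_of_nonneg hlog0] at this
      linarith
    have hpos : 0 < |r - ρ| := abs_pos.2 (sub_ne_zero.2 hρr.symm)
    have hfar : |x - Real.log (1 + ρ)| ^ (-(1:ℝ)/2) ≤ d * |r - ρ| ^ (-(1:ℝ)/2) := by
      rw [← Real.mul_rpow (by norm_num) hpos.le]
      exact Real.rpow_le_rpow_of_nonpos (by positivity)
        (by linarith [hrx ρ ⟨hρ0.le, hρ1⟩]) (by norm_num)
    refine (rpow_neg_half_mul_le (by positivity) hρ0.le (abs_nonneg _) hmax).trans ?_
    rw [Real.mul_rpow hx'.le (by norm_num)]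
    gcongr
  have hae : ∀ᵐ ρ ∂(MeasureTheory.volume.restrict (Set.Ioc (0:ℝ) 1)),
      ρ ^ (-(1:ℝ)/2) * |x - Real.log (1 + ρ)| ^ (-(1:ℝ)/2) ≤
        |x| ^ (-(1:ℝ)/2) * d * (ρ ^ (-(1:ℝ)/2) + d * |r - ρ| ^ (-(1:ℝ)/2)) := by
    filter_upwards [MeasureTheory.ae_restrict_mem measurableSet_Ioc,
      MeasureTheory.Measure.ae_ne _ r] with ρ hρ hρr
    exact hle ρ hρ hρr
  have h_int : IntervalIntegrable
      (fun ρ : ℝ => ρ ^ (-(1:ℝ)/2) * |x - Real.log (1 + ρ)| ^ (-(1:ℝ)/2))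
      MeasureTheory.volume 0 1 := by
    rw [intervalIntegrable_iff_integrableOn_Ioc_of_le zero_le_one] at hmaj ⊢
    refine MeasureTheory.Integrable.mono' hmaj
      (Measurable.aestronglyMeasurable (by fun_prop)) ?_
    filter_upwards [hae, MeasureTheory.ae_restrict_mem measurableSet_Ioc] with ρ h hρ
    rwa [Real.norm_of_nonneg
      (mul_nonneg (Real.rpow_nonneg hρ.1.le _) (Real.rpow_nonneg (abs_nonneg _) _))]
  refine ⟨h_int, ?_⟩
  calc (∫ ρ in (0:ℝ)..1, ρ ^ (-(1:ℝ)/2) * |x - Real.log (1 + ρ)| ^ (-(1:ℝ)/2))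
      ≤ ∫ ρ in (0:ℝ)..1,
          |x| ^ (-(1:ℝ)/2) * d * (ρ ^ (-(1:ℝ)/2) + d * |r - ρ| ^ (-(1:ℝ)/2)) := by
        rw [intervalIntegrable_iff_integrableOn_Ioc_of_le zero_le_one] at hmaj h_int
        rw [intervalIntegral.integral_of_le zero_le_one,
          intervalIntegral.integral_of_le zero_le_one]
        exact MeasureTheory.integral_mono_ae h_int hmaj hae
    _ = |x| ^ (-(1:ℝ)/2) * d * (L + d * ∫ ρ in (0:ℝ)..1, |r - ρ| ^ (-(1:ℝ)/2)) := by
        rw [intervalIntegral.integral_const_mul,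
          intervalIntegral.integral_add hmaj_rho (hmaj_r.const_mul d),
          intervalIntegral.integral_const_mul]
    _ ≤ |x| ^ (-(1:ℝ)/2) * d * (L + d * K) := by
        gcongr
        exact integral_abs_sub_rpow_neg_half_le hr
    _ ≤ (d * (L + d * K) + 1) * (|x| ^ (-(1:ℝ)/2) + 1) := by
        have h1 : 0 ≤ |x| ^ (-(1:ℝ)/2) := Real.rpow_nonneg hx'.le _
        have h2 : 0 ≤ d * (L + d * K) := by positivity
        nlinarith
end
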